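/- arXiv:2001.04833 — 3 statements merged into one kernel-verified Lean document; each statement's English description precedes it below -/
import Mathlib

section
/- Let Y be an integrable real random variable and τ ∈ (0,1). A real number q* minimizes the map q ↦ E[l_τ(Y − q)] over ℝ if and only if P(Y < q*) ≤ τ ≤ P(Y ≤ q*); in particular any τ-quantile of Y is a minimizer of the expected pinball loss. -/
open MeasureTheory Set

/-- The pinball loss of order `τ`: `l_τ(ξ) = (τ − 1_{ξ<0})·ξ`. -/
noncomputable def pinball (τ ξ : ℝ) : ℝ := (τ - if ξ < 0 then 1 else 0) * ξ

theorem pinball_eq_max (τ ξ : ℝ) : pinball τ ξ = max (τ * ξ) ((τ - 1) * ξ) := by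
  unfold pinball
  split_ifs with h
  · rw [max_eq_right (by nlinarith)]
  · rw [max_eq_left (by nlinarith), sub_zero]

theorem pinball_subgradient_lt (τ y a q : ℝ) :
    pinball τ (y - a) + ((Iio a).indicator 1 y - τ) * (q - a) ≤ pinball τ (y - q) := by
  rw [pinball_eq_max τ (y - q)]
  by_cases h : y < a
  · refine le_trans (le_of_eq ?_) (le_max_right _ _)
    simp [pinball, h]
    ring
  · refine le_trans (le_of_eq ?_) (le_max_left _ _)
    simp [pinball, h]
    ring

theorem pinball_subgradient_le (τ y a q : ℝ) :
    pinball τ (y - a) + ((Iic a).indicator 1 y - τ) * (q - a) ≤ pinball τ (y - q) := by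
  obtain h | rfl := ne_or_eq y a
  · simpa [indicator, h.le_iff_lt] using pinball_subgradient_lt τ y a q
  · rw [pinball_eq_max τ (y - q)]
    refine le_trans (le_of_eq ?_) (le_max_right _ _)
    simp [pinball]
    ring

section Expectation

variable {Ω : Type*} [MeasurableSpace Ω] {μ : Measure Ω} [IsProbabilityMeasure μ] {Y : Ω → ℝ}

theorem integrable_pinball (hY : Integrable Y μ) (τ q : ℝ) :
    Integrable (fun ω => pinball τ (Y ω - q)) μ := by
  have h := hY.sub (integrable_const q)
  simp only [pinball_eq_max]
  exact (h.const_mul τ).sup (h.const_mul (τ - 1))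

theorem integral_pinball_subgradient (hY : Integrable Y μ) {τ a q : ℝ} {s : Set ℝ}
    (hs : MeasurableSet s)
    (h : ∀ y, pinball τ (y - a) + (s.indicator 1 y - τ) * (q - a) ≤ pinball τ (y - q)) :
    ∫ ω, pinball τ (Y ω - a) ∂μ + (μ.real (Y ⁻¹' s) - τ) * (q - a)
      ≤ ∫ ω, pinball τ (Y ω - q) ∂μ := by
  have hns : NullMeasurableSet (Y ⁻¹' s) μ := hY.aemeasurable.nullMeasurableSet_preimage hs
  have hind : Integrable (fun ω => s.indicator (1 : ℝ → ℝ) (Y ω)) μ :=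
    (integrable_const (1 : ℝ)).indicator₀ hns
  have hval : ∫ ω, s.indicator (1 : ℝ → ℝ) (Y ω) ∂μ = μ.real (Y ⁻¹' s) := by
    change ∫ ω, (Y ⁻¹' s).indicator (fun _ => (1 : ℝ)) ω ∂μ = _
    rw [integral_indicator₀ hns]
    simp
  have hlin : Integrable (fun ω => (s.indicator 1 (Y ω) - τ) * (q - a)) μ :=
    (hind.sub (integrable_const τ)).mul_const (q - a)
  calc
    _ = ∫ ω, (pinball τ (Y ω - a) + (s.indicator 1 (Y ω) - τ) * (q - a)) ∂μ := by
      rw [integral_add (integrable_pinball hY τ a) hlin, integral_mul_const,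
        integral_sub hind (integrable_const τ), hval]
      simp
    _ ≤ _ := integral_mono ((integrable_pinball hY τ a).add hlin) (integrable_pinball hY τ q)
      fun ω => h (Y ω)

theorem integral_pinball_subgradient_lt (hY : Integrable Y μ) (τ a q : ℝ) :
    ∫ ω, pinball τ (Y ω - a) ∂μ + (μ.real {ω | Y ω < a} - τ) * (q - a)
      ≤ ∫ ω, pinball τ (Y ω - q) ∂μ :=
  integral_pinball_subgradient hY measurableSet_Iio fun y => pinball_subgradient_lt τ y a q

theorem integral_pinball_subgradient_le (hY : Integrable Y μ) (τ a q : ℝ) :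
    ∫ ω, pinball τ (Y ω - a) ∂μ + (μ.real {ω | Y ω ≤ a} - τ) * (q - a)
      ≤ ∫ ω, pinball τ (Y ω - q) ∂μ :=
  integral_pinball_subgradient hY measurableSet_Iic fun y => pinball_subgradient_le τ y a q

theorem measureReal_lt_le_of_forall_lt {a c : ℝ}
    (h : ∀ q < a, μ.real {ω | Y ω < q} ≤ c) : μ.real {ω | Y ω < a} ≤ c := by
  obtain ⟨u, hu, hua, hlim⟩ := exists_seq_strictMono_tendsto a
  have hU : {ω | Y ω < a} = ⋃ n, {ω | Y ω < u n} := by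
    ext ω
    simp only [mem_ofPred_eq, mem_iUnion]
    exact ⟨fun hω => (hlim.eventually_const_lt hω).exists, fun ⟨n, hn⟩ => hn.trans (hua n)⟩
  have ht := tendsto_measure_iUnion_atTop (μ := μ) (s := fun n => {ω | Y ω < u n})
    fun m n hmn ω hω => lt_of_lt_of_le hω (hu.monotone hmn)
  rw [← hU] at ht
  exact le_of_tendsto ((ENNReal.tendsto_toReal (measure_ne_top _ _)).comp ht)
    (.of_forall fun n => h (u n) (hua n))

theorem le_measureReal_le_of_forall_gt (hY : AEMeasurable Y μ) {a c : ℝ}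
    (h : ∀ q, a < q → c ≤ μ.real {ω | Y ω ≤ q}) : c ≤ μ.real {ω | Y ω ≤ a} := by
  obtain ⟨u, hu, hua, hlim⟩ := exists_seq_strictAnti_tendsto a
  have hU : {ω | Y ω ≤ a} = ⋂ n, {ω | Y ω ≤ u n} := by
    ext ω
    simp only [mem_ofPred_eq, mem_iInter]
    exact ⟨fun hω n => hω.trans (hua n).le, fun hω => ge_of_tendsto' hlim hω⟩
  have ht := tendsto_measure_iInter_atTop (μ := μ) (s := fun n => {ω | Y ω ≤ u n})
    (fun n => hY.nullMeasurableSet_preimage measurableSet_Iic)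
    (fun m n hmn ω hω => le_trans hω (hu.antitone hmn)) ⟨0, measure_ne_top _ _⟩
  rw [← hU] at ht
  exact ge_of_tendsto ((ENNReal.tendsto_toReal (measure_ne_top _ _)).comp ht)
    (.of_forall fun n => h (u n) (hua n))

end Expectation

/-- A real number `q⋆` minimizes `q ↦ E[l_τ(Y − q)]` over `ℝ` if and only if
`P(Y < q⋆) ≤ τ ≤ P(Y ≤ q⋆)`, i.e. iff `q⋆` is a `τ`-quantile of `Y`. -/
theorem pinball_minimizer_iff_quantile
    {Ω : Type*} [MeasurableSpace Ω] (μ : Measure Ω) [IsProbabilityMeasure μ]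
    (Y : Ω → ℝ) (hY : Integrable Y μ) (τ : ℝ) (hτ : τ ∈ Set.Ioo (0 : ℝ) 1) (qstar : ℝ) :
    (∀ q : ℝ, ∫ ω, pinball τ (Y ω - qstar) ∂μ ≤ ∫ ω, pinball τ (Y ω - q) ∂μ)
      ↔ ((μ {ω | Y ω < qstar}).toReal ≤ τ ∧ τ ≤ (μ {ω | Y ω ≤ qstar}).toReal) := by
  simp only [← measureReal_def]
  refine ⟨fun h => ⟨measureReal_lt_le_of_forall_lt fun q hq => ?_,
    le_measureReal_le_of_forall_gt hY.aemeasurable fun q hq => ?_⟩, fun ⟨hlt, hle⟩ q => ?_⟩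
  · have := integral_pinball_subgradient_lt hY τ q qstar
    nlinarith [h q]
  · have := integral_pinball_subgradient_le hY τ q qstar
    nlinarith [h q]
  · obtain hq | hq := le_total q qstar
    · have := integral_pinball_subgradient_lt hY τ qstar q
      nlinarith
    · have := integral_pinball_subgradient_le hY τ qstar q
      nlinarith
end

section
/- If the real random variable Y has the asymmetric Gaussian density with location e, scale σ > 0 and asymmetry τ ∈ (0,1), then τ·E[(Y − e)₊] = (1−τ)·E[(e − Y)₊]; i.e., the location parameter e is the τ-expectile of Y. -/
open MeasureTheory Real

/-- The squared pinball loss of order `τ`: `l^e_τ(ξ) = |τ − 1_{ξ<0}|·ξ²`. -/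
noncomputable def sqPinball (τ ξ : ℝ) : ℝ := |τ - if ξ < 0 then 1 else 0| * ξ ^ 2

/-- The normalizing constant of the asymmetric Gaussian density:
`C(τ,σ) = √(2τ(1−τ)) / (σ√π·(√τ + √(1−τ)))`. -/
noncomputable def asymGaussConst (τ σ : ℝ) : ℝ :=
  Real.sqrt (2 * τ * (1 - τ)) / (σ * Real.sqrt π * (Real.sqrt τ + Real.sqrt (1 - τ)))

/-- The first moment of the half-Gaussian weight `exp (-b * t ^ 2)` on `t > 0`. -/
theorem integral_max_zero_mul_exp_neg_mul_sq {b : ℝ} (hb : 0 < b) :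
    ∫ t : ℝ, max t 0 * Real.exp (-b * t ^ 2) = (2 * b)⁻¹ := by
  have hcomplex := integral_mul_cexp_neg_mul_sq (b := (b : ℂ)) (by simpa using hb)
  have hreal : ∫ t in Set.Ioi (0 : ℝ), t * Real.exp (-b * t ^ 2) = (2 * b)⁻¹ := by
    apply Complex.ofReal_injective
    rw [← integral_complex_ofReal]
    push_cast
    exact hcomplex
  rw [← hreal, ← integral_indicator measurableSet_Ioi]
  congr 1 with t
  by_cases ht : 0 < t
  · simp [ht, ht.le]
  · simp [ht, not_lt.mp ht]

/-- Expectations under the asymmetric Gaussian law, as Lebesgue integrals in the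
centered variable. -/
theorem integral_sub_eq_integral_mul_asymGauss
    {Ω : Type*} [MeasurableSpace Ω] {μ : Measure Ω} {Y : Ω → ℝ} (hY : Measurable Y)
    {e σ τ : ℝ} (hσ : 0 < σ)
    (hlaw : μ.map Y
      = volume.withDensity
          (fun y => ENNReal.ofReal
            (asymGaussConst τ σ * Real.exp (-(sqPinball τ (y - e)) / (2 * σ ^ 2)))))
    {g : ℝ → ℝ} (hg : Measurable g) :
    ∫ ω, g (Y ω - e) ∂μ
      = asymGaussConst τ σ * ∫ t, g t * Real.exp (-(sqPinball τ t) / (2 * σ ^ 2)) := by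
  have hC : 0 ≤ asymGaussConst τ σ := by
    unfold asymGaussConst
    positivity
  have hpin : Measurable (sqPinball τ) := by
    unfold sqPinball
    exact (measurable_const.sub
      (Measurable.ite measurableSet_Iio measurable_const measurable_const)).abs.mul (by fun_prop)
  rw [← integral_map (f := fun y => g (y - e)) hY.aemeasurable
      (hg.comp (measurable_id.sub_const e)).aestronglyMeasurable, hlaw,
    integral_withDensity_eq_integral_toReal_smul (by fun_prop) (by simp),
    ← integral_const_mul, ← integral_sub_right_eq_self
      (fun t => asymGaussConst τ σ * (g t * Real.exp (-(sqPinball τ t) / (2 * σ ^ 2)))) e]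
  congr 1 with y
  rw [ENNReal.toReal_ofReal (by positivity), smul_eq_mul]
  ring

/-- If `Y` has the asymmetric Gaussian density with location `e`, scale `σ > 0`
and asymmetry `τ ∈ (0,1)`, then `τ·E[(Y − e)₊] = (1−τ)·E[(e − Y)₊]`:
the location parameter is the `τ`-expectile of `Y`. -/
theorem asymmetricGaussian_expectile
    {Ω : Type*} [MeasurableSpace Ω] (μ : Measure Ω) [IsProbabilityMeasure μ]
    (Y : Ω → ℝ) (hY : Measurable Y) (e σ τ : ℝ) (hσ : 0 < σ) (hτ : τ ∈ Set.Ioo (0 : ℝ) 1)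
    (hlaw : μ.map Y
      = volume.withDensity
          (fun y => ENNReal.ofReal
            (asymGaussConst τ σ * Real.exp (-(sqPinball τ (y - e)) / (2 * σ ^ 2))))) :
    τ * (∫ ω, max (Y ω - e) 0 ∂μ) = (1 - τ) * (∫ ω, max (e - Y ω) 0 ∂μ) := by
  obtain ⟨hτ0, hτ1⟩ := hτ
  have hτ1' : 0 < 1 - τ := sub_pos.mpr hτ1
  have hpos : ∫ t, max t 0 * Real.exp (-(sqPinball τ t) / (2 * σ ^ 2)) = σ ^ 2 / τ := by
    calc _ = ∫ t, max t 0 * Real.exp (-(τ / (2 * σ ^ 2)) * t ^ 2) := by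
            congr 1 with t
            rcases le_or_gt t 0 with ht | ht
            · simp [ht]
            · rw [sqPinball, if_neg ht.not_gt, sub_zero, abs_of_pos hτ0]
              ring_nf
      _ = _ := by
            rw [integral_max_zero_mul_exp_neg_mul_sq (by positivity)]
            field_simp
  have hneg : ∫ t, max (-t) 0 * Real.exp (-(sqPinball τ t) / (2 * σ ^ 2)) = σ ^ 2 / (1 - τ) := by
    calc _ = ∫ t, max (-t) 0 * Real.exp (-((1 - τ) / (2 * σ ^ 2)) * (-t) ^ 2) := by
            congr 1 with t
            rcases le_or_gt 0 t with ht | ht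
            · simp [ht]
            · rw [sqPinball, if_pos ht, abs_sub_comm, abs_of_pos hτ1']
              ring_nf
      _ = _ := by
            rw [integral_neg_eq_self
                (fun t : ℝ => max t 0 * Real.exp (-((1 - τ) / (2 * σ ^ 2)) * t ^ 2)),
              integral_max_zero_mul_exp_neg_mul_sq (by positivity)]
            field_simp
  have hright := integral_sub_eq_integral_mul_asymGauss hY hσ hlaw
    (g := fun t => max t 0) (by fun_prop)
  have hleft := integral_sub_eq_integral_mul_asymGauss hY hσ hlaw
    (g := fun t => max (-t) 0) (by fun_prop)
  simp only [neg_sub] at hleft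
  rw [hright, hleft, hpos, hneg]
  field_simp
end

section
/- Let p be a probability density on ℝ^d, α > 0, and suppose the stationary kernel k satisfies k(x,x') = α ∫_{ℝ^d} cos(wᵀ(x − x')) p(w) dw. If w ~ p(w) and b ~ U(0,2π) are independent, then for all x, x' ∈ ℝ^d, k(x,x') = 2α·E_{(w,b)}[cos(wᵀx + b)·cos(wᵀx' + b)]. -/
open MeasureTheory ProbabilityTheory Matrix Real

/-- The uniform probability measure on the interval `(0, 2π)`. -/
noncomputable def uniformTwoPi : Measure ℝ :=
  (ENNReal.ofReal (2 * π))⁻¹ • volume.restrict (Set.Ioo 0 (2 * π))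

/-- Averaging a product of two phase-shifted cosines over a uniform phase. -/
theorem integral_cos_add_mul_cos_add_uniformTwoPi (a c : ℝ) :
    ∫ t, Real.cos (a + t) * Real.cos (c + t) ∂uniformTwoPi = Real.cos (a - c) / 2 := by
  have hderiv : ∀ t ∈ Set.uIcc 0 (2 * π), HasDerivAt
      (fun t => Real.cos (a - c) / 2 * t + Real.sin (a + c + 2 * t) / 4)
      (Real.cos (a + t) * Real.cos (c + t)) t := by
    intro t _
    have h := ((hasDerivAt_id t).const_mul (Real.cos (a - c) / 2)).add
      ((((hasDerivAt_id t).const_mul 2).const_add (a + c)).sin.div_const 4)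
    refine h.congr_deriv ?_
    have hsum : a + c + 2 * t = (a + t) + (c + t) := by ring
    have hdiff : a - c = (a + t) - (c + t) := by ring
    simp only [id]
    rw [hsum, hdiff, Real.cos_add (a + t), Real.cos_sub (a + t)]
    ring
  have hint : ∫ t in (0 : ℝ)..2 * π, Real.cos (a + t) * Real.cos (c + t) =
      π * Real.cos (a - c) := by
    rw [intervalIntegral.integral_eq_sub_of_hasDerivAt hderiv
      (Continuous.intervalIntegrable (by fun_prop) _ _)]
    have hper : Real.sin (a + c + 2 * (2 * π)) = Real.sin (a + c) := by
      simpa using Real.sin_add_nat_mul_two_pi (a + c) 2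
    rw [hper]
    simp only [mul_zero, add_zero]
    ring
  rw [uniformTwoPi, integral_smul_measure, ← integral_Ioc_eq_integral_Ioo,
    ← intervalIntegral.integral_of_le Real.two_pi_pos.le, hint, ENNReal.toReal_inv,
    ENNReal.toReal_ofReal Real.two_pi_pos.le, smul_eq_mul]
  field_simp

/-- If the stationary kernel `k` satisfies `k(x,x') = α ∫ cos(wᵀ(x−x')) p(w) dw`
for a probability density `p` and `α > 0`, and if `w ~ p` and `b ~ U(0,2π)` are
independent, then `k(x,x') = 2α·E[cos(wᵀx+b)·cos(wᵀx'+b)]`. -/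
theorem kernel_eq_two_alpha_expectation_rff
    (d : ℕ) {Ω : Type*} [MeasurableSpace Ω] (μ : Measure Ω) [IsProbabilityMeasure μ]
    (p : (Fin d → ℝ) → ℝ) (hp0 : ∀ v, 0 ≤ p v)
    (hpdens : ∫ v, p v = 1)
    (α : ℝ) (hα : 0 < α)
    (k : (Fin d → ℝ) → (Fin d → ℝ) → ℝ)
    (hk : ∀ x x', k x x' = α * ∫ v, Real.cos (v ⬝ᵥ (x - x')) * p v)
    (w : Ω → (Fin d → ℝ)) (b : Ω → ℝ) (hw : Measurable w) (hb : Measurable b)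
    (hwlaw : μ.map w = volume.withDensity (fun v => ENNReal.ofReal (p v)))
    (hblaw : μ.map b = uniformTwoPi)
    (hindep : IndepFun w b μ)
    (x x' : Fin d → ℝ) :
    k x x' = 2 * α * ∫ ω, Real.cos (w ω ⬝ᵥ x + b ω) * Real.cos (w ω ⬝ᵥ x' + b ω) ∂μ := by
  have hp : Integrable p := Integrable.of_integral_ne_zero (by rw [hpdens]; exact one_ne_zero)
  have hwprob : IsProbabilityMeasure (μ.map w) := Measure.isProbabilityMeasure_map hw.aemeasurable
  have hbprob : IsProbabilityMeasure (μ.map b) := Measure.isProbabilityMeasure_map hb.aemeasurable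
  have hcont : Continuous fun z : (Fin d → ℝ) × ℝ =>
      Real.cos (z.1 ⬝ᵥ x + z.2) * Real.cos (z.1 ⬝ᵥ x' + z.2) := by
    fun_prop
  have hjoint : μ.map (fun ω => (w ω, b ω)) = (μ.map w).prod (μ.map b) :=
    (indepFun_iff_map_prod_eq_prod_map_map hw.aemeasurable hb.aemeasurable).1 hindep
  have hbdd : Integrable (fun z : (Fin d → ℝ) × ℝ =>
      Real.cos (z.1 ⬝ᵥ x + z.2) * Real.cos (z.1 ⬝ᵥ x' + z.2)) ((μ.map w).prod (μ.map b)) := by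
    refine Integrable.of_bound hcont.aestronglyMeasurable 1 (Filter.Eventually.of_forall fun z => ?_)
    rw [Real.norm_eq_abs, abs_mul]
    exact mul_le_one₀ (Real.abs_cos_le_one _) (abs_nonneg _) (Real.abs_cos_le_one _)
  have hexp : ∫ ω, Real.cos (w ω ⬝ᵥ x + b ω) * Real.cos (w ω ⬝ᵥ x' + b ω) ∂μ =
      ∫ v, Real.cos (v ⬝ᵥ (x - x')) / 2 ∂(μ.map w) := by
    rw [← integral_map (φ := fun ω => (w ω, b ω)) (hw.prodMk hb).aemeasurable
      hcont.aestronglyMeasurable, hjoint, integral_prod _ hbdd]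
    simp only [hblaw, integral_cos_add_mul_cos_add_uniformTwoPi, dotProduct_sub]
  rw [hexp, hk, integral_div, hwlaw, integral_withDensity_eq_integral_toReal_smul₀
    hp.aemeasurable.ennreal_ofReal (Filter.Eventually.of_forall fun _ => ENNReal.ofReal_lt_top)]
  simp only [ENNReal.toReal_ofReal (hp0 _), smul_eq_mul, mul_comm (p _)]
  ring
end
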